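/- There is no distal minimal action of an abelian group G by homeomorphisms on a compact metric space X which is simply connected and contains more than one point. In particular, the 2-sphere S² does not admit any distal minimal action by an abelian group. -/

import Mathlib

/-- The group of self-homeomorphisms of a topological space, under composition. -/
instance Homeomorph.instGroupSelf {X : Type*} [TopologicalSpace X] : Group (X ≃ₜ X) where
  mul a b := b.trans a
  one := Homeomorph.refl X
  inv := Homeomorph.symm
  mul_assoc _ _ _ := rfl
  one_mul a := Homeomorph.ext fun _ => rfl
  mul_one a := Homeomorph.ext fun _ => rfl
  inv_mul_cancel a := Homeomorph.ext fun x => a.symm_apply_apply x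

universe u v

namespace DistalAux

open MeasureTheory Set Filter Topology unitInterval


/-- Every circle-valued map has a Borel real lift which is continuous along paths. -/
def HasPathLifts (X : Type*) [TopologicalSpace X] [MeasurableSpace X] : Prop :=
  ∀ f : C(X, Circle), ∃ F : X → ℝ, Measurable F ∧ (∀ x, Circle.exp (F x) = f x) ∧
    ∀ γ : C(I, X), Continuous (F ∘ γ)

theorem exists_exp_eq (z : Circle) : ∃ t : ℝ, Circle.exp t = z :=
  ⟨Circle.argEquiv z, by simp⟩

/-- The endpoint relation of lifted paths. -/
def LiftRel {X : Type*} [TopologicalSpace X] (f : C(X, Circle)) (x₀ : X) (t₀ : ℝ)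
    (x : X) (r : ℝ) : Prop :=
  ∃ (γ : Path x₀ x) (Φ : Path t₀ r), ∀ t, Circle.exp (Φ t) = f (γ t)

theorem LiftRel.trans {X : Type*} [TopologicalSpace X] {f : C(X, Circle)} {x₀ x y : X}
    {t₀ r s : ℝ} (h : LiftRel f x₀ t₀ x r) (h' : LiftRel f x r y s) : LiftRel f x₀ t₀ y s := by
  obtain ⟨γ, Φ, h⟩ := h
  obtain ⟨γ', Φ', h'⟩ := h'
  refine ⟨γ.trans γ', Φ.trans Φ', fun t => ?_⟩
  simp only [Path.trans_apply]
  split_ifs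
  · exact h _
  · exact h' _

theorem LiftRel.unique {X : Type*} [TopologicalSpace X] [SimplyConnectedSpace X]
    {f : C(X, Circle)} {x₀ x : X} {t₀ r s : ℝ}
    (h : LiftRel f x₀ t₀ x r) (h' : LiftRel f x₀ t₀ x s) : r = s := by
  obtain ⟨γ, Φ, h⟩ := h
  obtain ⟨γ', Φ', h'⟩ := h'
  have e0 : f x₀ = Circle.exp t₀ := by simpa using (h 0).symm
  have key := Circle.isCoveringMap_exp.liftPath_apply_one_eq_of_homotopicRel
    (ContinuousMap.HomotopicRel.comp_continuousMap (SimplyConnectedSpace.paths_homotopic γ γ') f)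
    t₀ (by simpa using e0) (by simpa using e0)
  have h1 := (Circle.isCoveringMap_exp.eq_liftPath_iff' (γ := f.comp γ.toContinuousMap) (e := t₀)
    (γ_0 := by simpa using e0) (Γ := Φ.toContinuousMap)).2
      ⟨funext h, by simp⟩
  have h2 := (Circle.isCoveringMap_exp.eq_liftPath_iff' (γ := f.comp γ'.toContinuousMap) (e := t₀)
    (γ_0 := by simpa using e0) (Γ := Φ'.toContinuousMap)).2
      ⟨funext h', by simp⟩
  rw [← h1, ← h2] at key
  simpa using key

theorem LiftRel.along {X : Type*} [TopologicalSpace X] {f : C(X, Circle)}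
    (γ : C(I, X)) (Φ : C(I, ℝ)) (h : ∀ t, Circle.exp (Φ t) = f (γ t)) (t : I) :
    LiftRel f (γ 0) (Φ 0) (γ t) (Φ t) :=
  ⟨⟨⟨fun s => γ (t * s), by fun_prop⟩, by simp, by simp⟩,
   ⟨⟨fun s => Φ (t * s), by fun_prop⟩, by simp, by simp⟩, fun s => h _⟩

theorem exists_lift {X : Type*} [TopologicalSpace X] (f : C(X, Circle)) (γ : C(I, X)) (r : ℝ)
    (hr : Circle.exp r = f (γ 0)) : ∃ Φ : C(I, ℝ), (∀ t, Circle.exp (Φ t) = f (γ t)) ∧ Φ 0 = r := by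
  obtain ⟨Φ, h1, h2⟩ := Circle.isCoveringMap_exp.exists_path_lifts (f.comp γ) r (by simp [hr])
  exact ⟨Φ, fun t => congrFun h1 t, h2⟩

theorem hasPathLifts_of_simplyConnected (X : Type*) [MetricSpace X] [CompactSpace X]
    [SimplyConnectedSpace X] [MeasurableSpace X] [BorelSpace X] : HasPathLifts X := by
  intro f
  obtain ⟨x₀⟩ : Nonempty X := inferInstance
  obtain ⟨t₀, ht₀⟩ := exists_exp_eq (f x₀)
  have ex : ∀ x, ∃ r, LiftRel f x₀ t₀ x r := by
    intro x
    have γ : Path x₀ x := (PathConnectedSpace.joined x₀ x).somePath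
    obtain ⟨Φ, h1, h2⟩ := exists_lift f γ.toContinuousMap t₀ (by simp [ht₀])
    exact ⟨Φ 1, γ, ⟨Φ, h2, rfl⟩, h1⟩
  choose F hF using ex
  have hexp : ∀ x, Circle.exp (F x) = f x := by
    intro x
    obtain ⟨γ, Φ, h⟩ := hF x
    simpa using h 1
  have huniq : ∀ x r, LiftRel f x₀ t₀ x r → F x = r := fun x r h => (hF x).unique h
  refine ⟨F, ?_, hexp, ?_⟩
  · let S : Set (C(I, X) × C(I, ℝ)) :=
      {p | p.1 0 = x₀ ∧ p.2 0 = t₀ ∧ ∀ t, Circle.exp (p.2 t) = f (p.1 t)}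
    have hS : IsClosed S := by
      have hSe : S = {p | p.1 0 = x₀} ∩ ({p | p.2 0 = t₀} ∩
          ⋂ t, {p : C(I, X) × C(I, ℝ) | Circle.exp (p.2 t) = f (p.1 t)}) := by
        ext p
        simp only [S, mem_inter_iff, mem_iInter, mem_ofPred_eq]
      rw [hSe]
      exact IsClosed.inter (isClosed_eq (by fun_prop) (by fun_prop)) (IsClosed.inter
        (isClosed_eq (by fun_prop) (by fun_prop))
        (isClosed_iInter fun t => isClosed_eq (by fun_prop) (by fun_prop)))
    have : PolishSpace S := hS.polishSpace
    borelize ↥S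
    let p : S → X := fun q => q.1.1 1
    have hp : Continuous p := by fun_prop
    have hsurj : Function.Surjective p := by
      intro x
      obtain ⟨γ, Φ, h⟩ := hF x
      exact ⟨⟨(γ.toContinuousMap, Φ.toContinuousMap), by simp, by simp, h⟩, by simp [p]⟩
    rw [← hp.measurable.measurable_comp_iff_of_surjective hsurj]
    have : F ∘ p = fun q : S => q.1.2 1 := by
      ext q
      refine huniq _ _ ?_
      have := LiftRel.along q.1.1 q.1.2 q.2.2.2 1
      rwa [q.2.1, q.2.2.1] at this
    rw [this]
    apply Continuous.measurable
    fun_prop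
  · intro γ
    obtain ⟨Φ, h1, h2⟩ := exists_lift f γ (F (γ 0)) (hexp _)
    have : F ∘ γ = Φ := by
      ext t
      refine huniq _ _ ((hF (γ 0)).trans ?_)
      have := LiftRel.along γ Φ h1 t
      rwa [h2] at this
    rw [this]
    exact Φ.continuous

theorem eigenfunction_const {G X : Type*} [CommGroup G] [MulAction G X] [MetricSpace X]
    [CompactSpace X] [MeasurableSpace X] [BorelSpace X] [ContinuousConstSMul G X]
    [PathConnectedSpace X] (hX : HasPathLifts X) (hmin : ∀ x : X, Dense (range fun g : G => g • x))
    (μ : Measure X) [IsProbabilityMeasure μ] (hμ : ∀ g : G, MeasurePreserving (g • · : X → X) μ μ)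
    (f : C(X, Circle)) (χ : G → Circle) (hf : ∀ g x, f (g • x) = χ g * f x) (x y : X) :
    f x = f y := by
  obtain ⟨F, hFm, hFe, hFc⟩ := hX f
  have hconst : ∀ (g : G) (x y : X), F (g • x) - F x = F (g • y) - F y := by
    intro g x y
    have γ : Path x y := (PathConnectedSpace.joined x y).somePath
    have hc : Continuous fun t => F (g • γ t) - F (γ t) :=
      (hFc ⟨fun t => g • γ t, by fun_prop⟩).sub (hFc γ.toContinuousMap)
    have := Circle.isCoveringMap_exp.const_of_comp hc (fun s t => by
      simp [Circle.exp_sub, hFe, hf]) 0 1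
    simpa using this
  have hzero : ∀ (g : G) (x : X), F (g • x) = F x := by
    intro g x
    by_contra hne
    set c := F (g • x) - F x with hc
    have hc0 : c ≠ 0 := sub_ne_zero.2 hne
    have hstep : ∀ y, F (g • y) = F y + c := fun y => by
      have := hconst g x y
      linarith
    have hiter : ∀ (n : ℕ) y, F ((fun z : X => g • z)^[n] y) = F y + n * c := by
      intro n
      induction n with
      | zero => simp
      | succ n ih =>
        intro y
        rw [Function.iterate_succ_apply, ih, hstep]
        push_cast; ring
    have hpos : 0 < |c| := abs_pos.2 hc0
    obtain ⟨k, hk⟩ : ∃ k : ℤ, μ (F ⁻¹' Ico (k • |c|) ((k + 1) • |c|)) ≠ 0 := by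
      by_contra! hall
      have h0 : μ (⋃ k : ℤ, F ⁻¹' Ico (k • |c|) ((k + 1) • |c|)) = 0 :=
        measure_iUnion_null hall
      rw [← preimage_iUnion, iUnion_Ico_zsmul hpos, preimage_univ] at h0
      simp at h0
    obtain ⟨y, hy, m, hm, hmy⟩ := ((hμ g).conservative).exists_mem_iterate_mem
      (hFm measurableSet_Ico).nullMeasurableSet hk
    simp only [mem_preimage, hiter, mem_Ico, zsmul_eq_mul] at hy hmy
    push_cast at hy hmy
    have h1 : |(m : ℝ) * c| < |c| := by
      rw [abs_lt]; constructor <;> linarith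
    rw [abs_mul, Nat.abs_cast] at h1
    have : (1 : ℝ) ≤ m := by exact_mod_cast Nat.one_le_iff_ne_zero.2 hm
    nlinarith
  have hinv : ∀ (g : G) (z : X), f (g • z) = f z := fun g z => by
    rw [← hFe, hzero, hFe]
  have : ∀ z, f z = f x := by
    have hcl : IsClosed {z | f z = f x} := isClosed_eq (by fun_prop) (by fun_prop)
    have := closure_minimal (s := range fun g : G => g • x)
      (by rintro _ ⟨g, rfl⟩; exact hinv g x) hcl
    intro z
    exact this ((hmin x) z)
  exact (this y).symm


/-- Closed unit disc. -/
abbrev Disc : Set (EuclideanSpace ℝ (Fin 2)) := Metric.closedBall 0 1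

/-- The two-sphere. -/
abbrev S2 : Set (EuclideanSpace ℝ (Fin 3)) := Metric.sphere 0 1

theorem mem_disc_iff (p : EuclideanSpace ℝ (Fin 2)) : p ∈ Disc ↔ p 0 ^ 2 + p 1 ^ 2 ≤ 1 := by
  rw [mem_closedBall_zero_iff, ← sq_le_one_iff₀ (norm_nonneg _), EuclideanSpace.real_norm_sq_eq]
  simp [Fin.sum_univ_two]

theorem mem_S2_iff (p : EuclideanSpace ℝ (Fin 3)) :
    p ∈ S2 ↔ p 0 ^ 2 + p 1 ^ 2 + p 2 ^ 2 = 1 := by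
  rw [mem_sphere_zero_iff_norm, ← pow_eq_one_iff_of_nonneg (norm_nonneg _) two_ne_zero,
    EuclideanSpace.real_norm_sq_eq]
  simp [Fin.sum_univ_three]

/-- The hemisphere parametrisation. -/
noncomputable def hemi (s : ℝ) (hs : s ^ 2 = 1) : C(Disc, S2) where
  toFun p := ⟨!₂[p.1 0, p.1 1, s * Real.sqrt (1 - (p.1 0 ^ 2 + p.1 1 ^ 2))], by
    rw [mem_S2_iff]
    have := (mem_disc_iff p.1).1 p.2
    simp [mul_pow, hs, Real.sq_sqrt (sub_nonneg.2 this)]⟩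
  continuous_toFun := by fun_prop

/-- Projection of the sphere to the disc. -/
def projDisc : C(S2, Disc) where
  toFun p := ⟨!₂[p.1 0, p.1 1], by
    rw [mem_disc_iff]
    have := (mem_S2_iff p.1).1 p.2
    simp
    nlinarith [sq_nonneg (p.1 2)]⟩
  continuous_toFun := by fun_prop

theorem hemi_proj (s : ℝ) (hs : s ^ 2 = 1) (x : S2) (hx : 0 ≤ s * x.1 2) :
    hemi s hs (projDisc x) = x := by
  have h := (mem_S2_iff x.1).1 x.2
  have h2 : s * Real.sqrt (1 - (x.1 0 ^ 2 + x.1 1 ^ 2)) = x.1 2 := by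
    rw [show 1 - (x.1 0 ^ 2 + x.1 1 ^ 2) = (s * x.1 2) ^ 2 by rw [mul_pow, hs]; linarith,
      Real.sqrt_sq hx, ← mul_assoc, ← sq, hs, one_mul]
  ext i
  fin_cases i
  · simp [hemi, projDisc]
  · simp [hemi, projDisc]
  · simpa [hemi, projDisc] using h2

theorem disc_lift (f : C(Disc, Circle)) : ∃ F : C(Disc, ℝ), ∀ p, Circle.exp (F p) = f p := by
  have hc : Convex ℝ Disc := convex_closedBall _ _
  have : ContractibleSpace Disc := hc.contractibleSpace ⟨0, by simp⟩
  have : LocallyPathConnectedSpace Disc := hc.locallyPathConnectedSpace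
  obtain ⟨t₀, ht₀⟩ := exists_exp_eq (f ⟨0, by simp⟩)
  obtain ⟨F, hF, -⟩ := Circle.isCoveringMap_exp.existsUnique_continuousMap_lifts f _ t₀ ht₀
  exact ⟨F, fun p => congrFun hF.2 p⟩

theorem hasPathLifts_S2 [MeasurableSpace S2] [BorelSpace S2] : HasPathLifts S2 := by
  intro f
  obtain ⟨Fp, hFp⟩ := disc_lift (f.comp (hemi 1 (by norm_num)))
  obtain ⟨Fm, hFm⟩ := disc_lift (f.comp (hemi (-1) (by norm_num)))
  let A : Set (EuclideanSpace ℝ (Fin 2)) := Metric.sphere 0 1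
  have hA : PreconnectedSpace A := Subtype.preconnectedSpace
    (isPreconnected_sphere (by simp [← Module.finrank_eq_rank]) _ _)
  let ι : A → Disc := fun a => ⟨a.1, Metric.sphere_subset_closedBall a.2⟩
  have hι : Continuous ι := by fun_prop
  have hhemi : ∀ a : A, hemi 1 (by norm_num) (ι a) = hemi (-1) (by norm_num) (ι a) := by
    intro a
    have ha : a.1 0 ^ 2 + a.1 1 ^ 2 = 1 := by
      have := a.2
      rw [mem_sphere_zero_iff_norm, ← pow_eq_one_iff_of_nonneg (norm_nonneg _) two_ne_zero,
        EuclideanSpace.real_norm_sq_eq] at this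
      simpa [Fin.sum_univ_two] using this
    ext i
    simp [hemi, ι, ha]
  have hdiff : ∀ a b : A, Fp (ι a) - Fm (ι a) = Fp (ι b) - Fm (ι b) := by
    intro a b
    refine Circle.isCoveringMap_exp.const_of_comp
      (g := fun a => Fp (ι a) - Fm (ι a)) (by fun_prop) (fun s t => ?_) a b
    simp [Circle.exp_sub, hFp, hFm, hhemi]
  let a₀ : A := ⟨EuclideanSpace.single 0 1, by simp [A]⟩
  set c := Fp (ι a₀) - Fm (ι a₀) with hc
  have hexpc : Circle.exp c = 1 := by
    simp [hc, Circle.exp_sub, hFp, hFm, hhemi]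
  let F : S2 → ℝ := fun x => if 0 ≤ x.1 2 then Fp (projDisc x) else Fm (projDisc x) + c
  have hF : Continuous F := by
    refine Continuous.if_le (by fun_prop) (by fun_prop) (by fun_prop) (by fun_prop) ?_
    intro x hx
    have hmem : (projDisc x).1 ∈ A := by
      have h := (mem_S2_iff x.1).1 x.2
      rw [← hx] at h
      simp only [A]
      rw [mem_sphere_zero_iff_norm, ← pow_eq_one_iff_of_nonneg (norm_nonneg _) two_ne_zero,
        EuclideanSpace.real_norm_sq_eq]
      simpa [Fin.sum_univ_two, projDisc] using h
    have := hdiff ⟨_, hmem⟩ a₀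
    have e : ι ⟨_, hmem⟩ = projDisc x := rfl
    rw [e] at this
    linarith
  refine ⟨F, hF.measurable, fun x => ?_, fun γ => hF.comp γ.continuous⟩
  by_cases hx : 0 ≤ x.1 2
  · simp [F, hx, hFp, hemi_proj 1 _ x (by simpa using hx)]
  · simp [F, hx, hFm, hemi_proj (-1) _ x (by simpa using (not_le.1 hx).le), Circle.exp_add, hexpc]


theorem step_invariant {X : Type*} [MetricSpace X]
    [CompactSpace X] [MeasurableSpace X] [BorelSpace X] (T : X → X) (hT : Continuous T)
    (K : Set (ProbabilityMeasure X)) (hK : IsClosed K)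
    (hKT : ∀ ν ∈ K, ν.map hT.measurable.aemeasurable ∈ K)
    (hKconv : ∀ (n : ℕ) (ν : ℕ → ProbabilityMeasure X) (m : ProbabilityMeasure X),
      (∀ k, ν k ∈ K) →
      (m : Measure X) = ((n + 1 : ℕ) : ENNReal)⁻¹ • ∑ k ∈ Finset.range (n + 1), (ν k : Measure X) →
      m ∈ K) (hne : K.Nonempty) :
    ∃ ν ∈ K, ν.map hT.measurable.aemeasurable = ν := by
  obtain ⟨ν₀, hν₀⟩ := hne
  let A : ProbabilityMeasure X → ProbabilityMeasure X := fun ν => ν.map hT.measurable.aemeasurable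
  let ν : ℕ → ProbabilityMeasure X := fun k => A^[k] ν₀
  have hν : ∀ k, ν k ∈ K := by
    intro k
    induction k with
    | zero => exact hν₀
    | succ k ih =>
      simp only [ν, Function.iterate_succ_apply']
      exact hKT _ ih
  have hm : ∀ n : ℕ, IsProbabilityMeasure (((n + 1 : ℕ) : ENNReal)⁻¹ •
      ∑ k ∈ Finset.range (n + 1), (ν k : Measure X)) := by
    intro n
    constructor
    simp only [Measure.smul_apply, Measure.finsetSum_apply, measure_univ, Finset.sum_const,
      Finset.card_range, smul_eq_mul, nsmul_eq_mul, mul_one]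
    exact ENNReal.inv_mul_cancel (by simp) (ENNReal.natCast_ne_top _)
  let m : ℕ → ProbabilityMeasure X := fun n => ⟨_, hm n⟩
  have hmK : ∀ n, m n ∈ K := fun n => hKconv n ν (m n) hν rfl
  let U : Ultrafilter ℕ := hyperfilter ℕ
  have hU : (U : Filter ℕ) ≤ atTop := by
    rw [← Nat.cofinite_eq_atTop]; exact hyperfilter_le_cofinite
  obtain ⟨μ, -, hμ⟩ := (isCompact_univ (X := ProbabilityMeasure X)).ultrafilter_le_nhds
    (U.map m) (by simp)
  have hμ : Tendsto m U (𝓝 μ) := hμ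
  refine ⟨μ, hK.mem_of_tendsto hμ (Eventually.of_forall hmK), ?_⟩
  have h1 : Tendsto (fun n => A (m n)) U (𝓝 (A μ)) :=
    ((ProbabilityMeasure.continuous_map hT).tendsto μ).comp hμ
  suffices h2 : Tendsto (fun n => A (m n)) U (𝓝 μ) from tendsto_nhds_unique h1 h2
  rw [ProbabilityMeasure.tendsto_iff_forall_integral_tendsto] at hμ ⊢
  intro f
  have hint : ∀ ν : ProbabilityMeasure X, Integrable f (ν : Measure X) := fun ν => f.integrable _
  have hA : ∀ ν : ProbabilityMeasure X, ∫ x, f x ∂(A ν : Measure X) = ∫ x, f (T x) ∂(ν : Measure X) := by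
    intro ν
    simp only [A, ProbabilityMeasure.toMeasure_map]
    exact integral_map hT.aemeasurable f.continuous.aestronglyMeasurable
  have hmi : ∀ n (φ : BoundedContinuousFunction X ℝ), ∫ x, φ x ∂(m n : Measure X) =
      ((n + 1 : ℕ) : ℝ)⁻¹ * ∑ k ∈ Finset.range (n + 1), ∫ x, φ x ∂(ν k : Measure X) := by
    intro n φ
    simp only [m, ProbabilityMeasure.coe_mk]
    rw [integral_smul_measure, integral_finsetSum_measure (fun i _ => φ.integrable _), smul_eq_mul,
      ENNReal.toReal_inv, ENNReal.toReal_natCast]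
  have hdiff : ∀ n, ∫ x, f x ∂(A (m n) : Measure X) - ∫ x, f x ∂(m n : Measure X) =
      ((n + 1 : ℕ) : ℝ)⁻¹ * (∫ x, f x ∂(ν (n + 1) : Measure X) - ∫ x, f x ∂(ν 0 : Measure X)) := by
    intro n
    have e := hmi n (f.compContinuous ⟨T, hT⟩)
    simp only [BoundedContinuousFunction.compContinuous_apply, ContinuousMap.coe_mk] at e
    rw [hA, e, hmi n f, ← mul_sub, ← Finset.sum_sub_distrib,
      ← Finset.sum_range_sub (fun k => ∫ x, f x ∂(ν k : Measure X))]
    congr 1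
    refine Finset.sum_congr rfl fun k _ => ?_
    have : ν (k + 1) = A (ν k) := by simp only [ν, Function.iterate_succ_apply']
    rw [this, hA]
  have hbound : ∀ ν : ProbabilityMeasure X, |∫ x, f x ∂(ν : Measure X)| ≤ ‖f‖ := by
    intro ν
    exact f.norm_integral_le_norm (ν : Measure X)
  have hz : Tendsto (fun n => ∫ x, f x ∂(A (m n) : Measure X) - ∫ x, f x ∂(m n : Measure X))
      atTop (𝓝 0) := by
    have hlim : Tendsto (fun n : ℕ => ((n + 1 : ℕ) : ℝ)⁻¹ * (2 * ‖f‖)) atTop (𝓝 0) := by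
      have := ((tendsto_inv_atTop_nhds_zero_nat (𝕜 := ℝ)).comp (tendsto_add_atTop_nat 1)).mul_const
        (2 * ‖f‖)
      simpa using this
    refine squeeze_zero_norm (fun n => ?_) hlim
    rw [hdiff, norm_mul, Real.norm_of_nonneg (by positivity)]
    gcongr
    rw [Real.norm_eq_abs]
    refine (abs_sub _ _).trans ?_
    linarith [hbound (ν (n + 1)), hbound (ν 0)]
  have := (hz.mono_left hU).add (hμ f)
  simpa using this

theorem exists_invariant_measure (G X : Type*) [CommGroup G] [MulAction G X] [MetricSpace X]
    [CompactSpace X] [MeasurableSpace X] [BorelSpace X] [ContinuousConstSMul G X] [Nonempty X] :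
    ∃ μ : Measure X, IsProbabilityMeasure μ ∧
      ∀ g : G, MeasurePreserving (g • · : X → X) μ μ := by
  classical
  have hc : ∀ g : G, Continuous (g • · : X → X) := fun g => continuous_const_smul g
  let A : G → ProbabilityMeasure X → ProbabilityMeasure X := fun g ν =>
    ν.map (hc g).measurable.aemeasurable
  have hAc : ∀ g, Continuous (A g) := fun g => ProbabilityMeasure.continuous_map (hc g)
  have hAA : ∀ g h ν, A g (A h ν) = A h (A g ν) := by
    intro g h ν
    apply Subtype.ext
    simp only [A, ProbabilityMeasure.toMeasure_map, ProbabilityMeasure.val_eq_to_measure]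
    rw [Measure.map_map (hc g).measurable (hc h).measurable,
      Measure.map_map (hc h).measurable (hc g).measurable]
    congr 1
    ext x
    exact smul_comm g h x
  let K : G → Set (ProbabilityMeasure X) := fun g => {ν | A g ν = ν}
  have hKc : ∀ g, IsClosed (K g) := fun g => isClosed_eq (hAc g) continuous_id
  have hfin : ∀ s : Finset G, (⋂ g ∈ s, K g).Nonempty := by
    intro s
    induction s using Finset.induction_on with
    | empty =>
      obtain ⟨x⟩ := ‹Nonempty X›
      exact ⟨⟨Measure.dirac x, inferInstance⟩, mem_iInter₂.2 (by simp)⟩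
    | insert g s _ ih =>
      obtain ⟨ν, hν, hν'⟩ := step_invariant (g • · : X → X) (hc g) (⋂ g ∈ s, K g)
        (isClosed_biInter fun g _ => hKc g)
        (by
          intro ν hν
          simp only [mem_iInter] at hν ⊢
          intro h hh
          have := hν h hh
          change A h (A g ν) = A g ν
          rw [hAA, show A h ν = ν from this])
        (by
          intro n ν m hν hm
          simp only [mem_iInter] at hν ⊢
          intro h hh
          change A h m = m
          apply Subtype.ext
          simp only [A, ProbabilityMeasure.toMeasure_map, ProbabilityMeasure.val_eq_to_measure]
          rw [hm, Measure.map_smul, Measure.map_finset_sum (hc h).aemeasurable]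
          congr 1
          refine Finset.sum_congr rfl fun k _ => ?_
          have := congrArg (fun ν : ProbabilityMeasure X => (ν : Measure X)) (hν k h hh)
          simpa [A] using this) ih
      refine ⟨ν, ?_⟩
      simp only [Finset.mem_insert, iInter_iInter_eq_or_left]
      exact ⟨hν', hν⟩
  obtain ⟨μ, hμ⟩ : (⋂ g, K g).Nonempty := by
    by_contra hemp
    rw [not_nonempty_iff_eq_empty] at hemp
    obtain ⟨s, hs⟩ := (isCompact_univ (X := ProbabilityMeasure X)).elim_finite_subfamily_closed K
      hKc (by simp [hemp])
    have := hfin s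
    simp [nonempty_iff_ne_empty] at this hs
    exact this hs
  refine ⟨μ, inferInstance, fun g => ⟨(hc g).measurable, ?_⟩⟩
  have := congrArg (fun ν : ProbabilityMeasure X => (ν : Measure X)) (mem_iInter.1 hμ g)
  simpa [A] using this


theorem exists_proper_closed {G X : Type*} [CommGroup G] [MulAction G X] [MetricSpace X]
    [CompactSpace X] [ContinuousConstSMul G X]
    (hdist : ∀ x y : X, x ≠ y → 0 < ⨅ g : G, dist (g • x) (g • y)) (hne : ∃ x y : X, x ≠ y) :
    ∃ W : Set (X × X), IsClosed W ∧ (∀ (g : G) p, p ∈ W → g • p ∈ W) ∧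
      (∃ U V : Set X, IsOpen U ∧ IsOpen V ∧ U.Nonempty ∧ V.Nonempty ∧ U ×ˢ V ⊆ W) ∧
      ∃ p, p ∉ W := by
  by_contra hcon
  have hdense : ∀ O : Set (X × X), IsOpen O → O.Nonempty →
      Dense (⋃ g : G, (fun p => g • p) ⁻¹' O) := by
    intro O hO hOne
    by_contra hnd
    apply hcon
    refine ⟨closure (⋃ g : G, (fun p => g • p) ⁻¹' O), isClosed_closure, ?_, ?_, ?_⟩
    · intro g p hp
      refine map_mem_closure (f := fun p : X × X => g • p) (continuous_const_smul g) hp ?_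
      intro q hq
      simp only [mem_iUnion, mem_preimage] at hq ⊢
      obtain ⟨h, hh⟩ := hq
      exact ⟨h * g⁻¹, by simpa [smul_smul] using hh⟩
    · obtain ⟨⟨a, b⟩, hab⟩ := hOne
      obtain ⟨U, V, hU, hV, ha, hb, hUV⟩ := isOpen_prod_iff.1 hO a b hab
      refine ⟨U, V, hU, hV, ⟨a, ha⟩, ⟨b, hb⟩, hUV.trans (Subset.trans ?_ subset_closure)⟩
      intro q hq
      exact mem_iUnion.2 ⟨1, by simpa using hq⟩
    · by_contra! h
      exact hnd h
  have hopen : ∀ O : Set (X × X), IsOpen O → IsOpen (⋃ g : G, (fun p => g • p) ⁻¹' O) :=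
    fun O hO => isOpen_iUnion fun g => hO.preimage (continuous_const_smul g)
  let B := TopologicalSpace.countableBasis (X × X)
  have hB := TopologicalSpace.isBasis_countableBasis (X × X)
  have hdd : Dense (⋂ O ∈ B, ⋃ g : G, (fun p : X × X => g • p) ⁻¹' O) := by
    refine dense_biInter_of_isOpen (fun O hO => hopen O (hB.isOpen hO))
      (TopologicalSpace.countable_countableBasis _) fun O hO => hdense O (hB.isOpen hO)
        (TopologicalSpace.nonempty_of_mem_countableBasis hO)
  obtain ⟨x₁, x₂, hx⟩ := hne
  have : Nonempty (X × X) := ⟨(x₁, x₂)⟩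
  obtain ⟨⟨a, b⟩, hab⟩ := hdd.nonempty
  have hhit : ∀ O : Set (X × X), IsOpen O → O.Nonempty → ∃ g : G, (g • a, g • b) ∈ O := by
    intro O hO ⟨q, hq⟩
    obtain ⟨O', hO', _, hsub⟩ := hB.exists_subset_of_mem_open hq hO
    obtain ⟨g, hg⟩ := mem_iUnion.1 (mem_iInter₂.1 hab O' hO')
    exact ⟨g, hsub hg⟩
  by_cases h : a = b
  · obtain ⟨g, hg⟩ := hhit {p | p.1 ≠ p.2} (isOpen_ne_fun continuous_fst continuous_snd)
      ⟨(x₁, x₂), hx⟩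
    exact hg (by simp [h])
  · obtain ⟨g, hg⟩ := hhit {p | dist p.1 p.2 < ⨅ g : G, dist (g • a) (g • b)}
      (isOpen_lt (by fun_prop) (by fun_prop)) ⟨(x₁, x₁), by simpa using hdist a b h⟩
    have hle : ⨅ g : G, dist (g • a) (g • b) ≤ dist (g • a) (g • b) :=
      ciInf_le ⟨0, by rintro _ ⟨g, rfl⟩; exact dist_nonneg⟩ g
    exact absurd hg (not_lt.2 hle)

open scoped symmDiff in
theorem exists_equivariant_map {G X : Type*} [CommGroup G] [MulAction G X] [MetricSpace X]
    [CompactSpace X] [MeasurableSpace X] [BorelSpace X] [ContinuousConstSMul G X]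
    (hmin : ∀ x : X, Dense (range fun g : G => g • x))
    (μ : Measure X) [IsProbabilityMeasure μ] [μ.IsOpenPosMeasure]
    (hμ : ∀ g : G, MeasurePreserving (g • · : X → X) μ μ)
    (W : Set (X × X)) (hW : IsClosed W) (hWG : ∀ (g : G) p, p ∈ W → g • p ∈ W)
    (U V : Set X) (hV : IsOpen V) (hUne : U.Nonempty) (hVne : V.Nonempty)
    (hUV : U ×ˢ V ⊆ W) (p₀ : X × X) (hp₀ : p₀ ∉ W) :
    ∃ (T : G → Lp ℂ 2 μ →ₗᵢ[ℂ] Lp ℂ 2 μ) (v : X → Lp ℂ 2 μ),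
      (∀ g h x, T g (T h x) = T h (T g x)) ∧ Continuous v ∧ (∀ g x, v (g • x) = T g (v x)) ∧
      ∃ x y, v x ≠ v y := by
  let S : X → Set X := fun x => Prod.mk x ⁻¹' W
  have hSc : ∀ x, IsClosed (S x) := fun x => hW.preimage (by fun_prop)
  have hSm : ∀ x, MeasurableSet (S x) := fun x => (hSc x).measurableSet
  have hSg : ∀ (g : G) x, S (g • x) = (g⁻¹ • · : X → X) ⁻¹' S x := by
    intro g x
    ext y
    constructor
    · intro hy
      have := hWG g⁻¹ _ hy
      simpa [S] using this
    · intro hy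
      have := hWG g _ hy
      simpa [S] using this
  have hφg : ∀ (g : G) x, μ (S (g • x)) = μ (S x) := by
    intro g x
    rw [hSg]
    exact (hμ g⁻¹).measure_preimage (hSm x).nullMeasurableSet
  have htube : ∀ x₀ (O : Set X), IsOpen O → S x₀ ⊆ O → ∀ᶠ x in 𝓝 x₀, S x ⊆ O := by
    intro x₀ O hO hsub
    have hcl : IsClosed (Prod.fst '' (W ∩ Prod.snd ⁻¹' Oᶜ)) :=
      isClosedMap_fst_of_compactSpace _ (hW.inter (hO.isClosed_compl.preimage continuous_snd))
    have hmem : x₀ ∈ (Prod.fst '' (W ∩ Prod.snd ⁻¹' Oᶜ))ᶜ := by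
      rintro ⟨⟨a, b⟩, ⟨h1, h2⟩, rfl⟩
      exact h2 (hsub h1)
    filter_upwards [hcl.isOpen_compl.mem_nhds hmem] with x hx y hy
    by_contra hyO
    exact hx ⟨(x, y), ⟨hy, hyO⟩, rfl⟩
  have hreg : ∀ x₀, ∀ ε : ENNReal, ε ≠ 0 → ∃ O, IsOpen O ∧ S x₀ ⊆ O ∧ μ O < μ (S x₀) + ε := by
    intro x₀ ε hε
    obtain ⟨O, h1, h2, h3⟩ := (S x₀).exists_isOpen_lt_of_lt (μ := μ) (μ (S x₀) + ε)
      (ENNReal.lt_add_right (measure_ne_top _ _) hε)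
    exact ⟨O, h2, h1, h3⟩
  have hle : ∀ x y, μ (S x) ≤ μ (S y) := by
    intro x y
    refine ENNReal.le_of_forall_pos_le_add fun ε hε _ => ?_
    obtain ⟨O, hO, hsub, hlt⟩ := hreg y ε (by exact_mod_cast hε.ne')
    obtain ⟨O', hO', hO'open, hyO'⟩ := eventually_nhds_iff.1 (htube y O hO hsub)
    obtain ⟨z, hz, ⟨g, rfl⟩⟩ := (hmin x).inter_open_nonempty O' hO'open ⟨y, hyO'⟩
    rw [← hφg g x]
    exact (measure_mono (hO' _ hz)).trans hlt.le
  have heq : ∀ x y, μ (S x) = μ (S y) := fun x y => le_antisymm (hle x y) (hle y x)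
  have htend : ∀ x₀, Tendsto (fun x => μ (S x ∆ S x₀)) (𝓝 x₀) (𝓝 0) := by
    intro x₀
    rw [ENNReal.tendsto_nhds_zero]
    intro ε hε
    obtain ⟨O, hO, hsub, hlt⟩ := hreg x₀ (ε / 2) (ENNReal.half_pos hε.ne').ne'
    filter_upwards [htube x₀ O hO hsub] with x hx
    have h1 : μ (S x \ S x₀) ≤ ε / 2 := by
      refine (measure_mono (sdiff_subset_sdiff_left hx)).trans ?_
      rw [measure_sdiff hsub (hSm x₀).nullMeasurableSet (measure_ne_top _ _)]
      exact tsub_le_iff_left.2 hlt.le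
    have h2 : μ (S x₀ \ S x) = μ (S x \ S x₀) := by
      have e1 := measure_inter_add_sdiff (μ := μ) (S x) (hSm x₀)
      have e2 := measure_inter_add_sdiff (μ := μ) (S x₀) (hSm x)
      rw [inter_comm, heq x₀ x, ← e1] at e2
      exact (ENNReal.add_right_inj (measure_ne_top _ _)).1 e2
    calc μ (S x ∆ S x₀) ≤ μ (S x \ S x₀) + μ (S x₀ \ S x) := measure_union_le _ _
      _ ≤ ε / 2 + ε / 2 := by rw [h2]; gcongr
      _ = ε := ENNReal.add_halves ε
  refine ⟨fun g => Lp.compMeasurePreservingₗᵢ ℂ (g⁻¹ • · : X → X) (hμ g⁻¹),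
    fun x => indicatorConstLp 2 (hSm x) (measure_ne_top _ _) (1 : ℂ), ?_, ?_, ?_, ?_⟩
  · intro g h f
    change Lp.compMeasurePreserving _ (hμ g⁻¹) (Lp.compMeasurePreserving _ (hμ h⁻¹) f) =
      Lp.compMeasurePreserving _ (hμ h⁻¹) (Lp.compMeasurePreserving _ (hμ g⁻¹) f)
    rw [← Lp.compMeasurePreserving_comp_apply, ← Lp.compMeasurePreserving_comp_apply]
    congr 2
    ext x
    exact smul_comm _ _ _
  · exact continuous_indicatorConstLp_set (by simp) htend
  · intro g x
    change _ = Lp.compMeasurePreserving _ (hμ g⁻¹) _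
    rw [Lp.indicatorConstLp_compMeasurePreserving]
    have key : ∀ (s t : Set X) (hs : MeasurableSet s) (ht : MeasurableSet t), s = t →
        indicatorConstLp 2 hs (measure_ne_top μ _) (1 : ℂ) =
          indicatorConstLp 2 ht (measure_ne_top μ _) (1 : ℂ) := by
      rintro s _ hs ht rfl; rfl
    exact key _ _ _ _ (hSg g x)
  · by_contra! hall
    obtain ⟨x, hx⟩ := hUne
    apply hp₀
    obtain ⟨a, b⟩ := p₀
    have hVS : ∀ y, V ⊆ S y := by
      intro y
      have h1 := (indicatorConstLp_inj (hSm x) (measure_ne_top _ _) (hSm y) (measure_ne_top _ _)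
        (one_ne_zero (α := ℂ))).1 (hall x y)
      have h2 : μ (V \ S y) = 0 :=
        measure_mono_null (sdiff_subset_sdiff_left fun z hz => hUV (mk_mem_prod hx hz))
          (ae_le_set.1 h1.le)
      have h3 : V \ S y = ∅ := by
        have := (hV.sdiff (hSc y)).measure_eq_zero_iff μ
        exact this.1 h2
      exact sdiff_eq_empty.1 h3
    obtain ⟨z, hz, ⟨g, rfl⟩⟩ := (hmin b).inter_open_nonempty V hV hVne
    have := hWG g⁻¹ _ (hVS (g • a) hz)
    simpa using this


theorem common_eigenvector {G H : Type*} [AddCommGroup H] [Module ℂ H]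
    (T : G → Module.End ℂ H) (hT : ∀ g h x, T g (T h x) = T h (T g x)) (n : ℕ) :
    ∀ E : Submodule ℂ H, FiniteDimensional ℂ E → Module.finrank ℂ E = n → E ≠ ⊥ →
      (∀ g, ∀ x ∈ E, T g x ∈ E) → ∃ x ∈ E, x ≠ 0 ∧ ∀ g, ∃ c : ℂ, T g x = c • x := by
  induction n using Nat.strong_induction_on with
  | _ n ih =>
    intro E hfin hn hE hinv
    by_cases hall : ∀ g, ∃ c : ℂ, ∀ x ∈ E, T g x = c • x
    · obtain ⟨x, hx, hx0⟩ := E.ne_bot_iff.1 hE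
      exact ⟨x, hx, hx0, fun g => (hall g).imp fun c hc => hc x hx⟩
    · push Not at hall
      obtain ⟨g, hg⟩ := hall
      have : Nontrivial E := Submodule.nontrivial_iff_ne_bot.2 hE
      obtain ⟨c, hc⟩ := Module.End.exists_eigenvalue ((T g).restrict (hinv g))
      obtain ⟨⟨w, hwE⟩, hw⟩ := hc.exists_hasEigenvector
      have hwc : T g w = c • w := by
        have := congrArg Subtype.val hw.apply_eq_smul
        simpa using this
      have hw0 : w ≠ 0 := by
        intro h
        exact hw.2 (Subtype.ext h)
      obtain ⟨y, hyE, hy⟩ := hg c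
      let E' : Submodule ℂ H := E ⊓ Module.End.eigenspace (T g) c
      have hlt : E' < E := by
        refine lt_of_le_of_ne inf_le_left fun h => hy ?_
        have : y ∈ E' := h ▸ hyE
        exact Module.End.mem_eigenspace_iff.1 this.2
      have hfin' : FiniteDimensional ℂ E' := Submodule.finiteDimensional_of_le hlt.le
      obtain ⟨x, hx, h⟩ := ih (Module.finrank ℂ E') (hn ▸ Submodule.finrank_lt_finrank_of_lt hlt)
        E' hfin' rfl
        (Submodule.ne_bot_iff _ |>.2 ⟨w, ⟨hwE, Module.End.mem_eigenspace_iff.2 hwc⟩, hw0⟩)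
        (by
          intro h x hx
          refine ⟨hinv h x hx.1, Module.End.mem_eigenspace_iff.2 ?_⟩
          rw [hT, Module.End.mem_eigenspace_iff.1 hx.2, map_smul])
      exact ⟨x, hx.1, h⟩

theorem exists_eigenfunction {G X H : Type*} [CommGroup G] [MulAction G X] [MetricSpace X]
    [CompactSpace X] [MeasurableSpace X] [BorelSpace X] [ContinuousConstSMul G X]
    [NormedAddCommGroup H] [InnerProductSpace ℂ H] [CompleteSpace H]
    (μ : Measure X) [IsProbabilityMeasure μ] [μ.IsOpenPosMeasure]
    (hμ : ∀ g : G, MeasurePreserving (g • · : X → X) μ μ)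
    (T : G → H →ₗᵢ[ℂ] H) (v : X → H)
    (hT : ∀ g h x, T g (T h x) = T h (T g x)) (hv : Continuous v)
    (hvT : ∀ g x, v (g • x) = T g (v x)) (hne : ∃ x y, v x ≠ v y) :
    ∃ (f : X → ℂ) (χ : G → ℂ), Continuous f ∧ (∀ g, ‖χ g‖ = 1) ∧
      (∀ g x, f (g • x) = χ g * f x) ∧ ∃ x y, f x ≠ f y := by
  have hint : ∀ {E : Type _} [NormedAddCommGroup E] (φ : X → E), Continuous φ →
      Integrable φ μ := by
    intro E _ φ hφ
    exact hφ.integrable_of_hasCompactSupport (HasCompactSupport.of_compactSpace φ)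
  have hemb : ∀ g : G, MeasurableEmbedding (g • · : X → X) := fun g =>
    (Homeomorph.smul g).measurableEmbedding
  set m := ∫ x, v x ∂μ with hm
  have hTm : ∀ g, T g m = m := by
    intro g
    have h1 : T g m = ∫ x, T g (v x) ∂μ :=
      ((T g).toContinuousLinearMap.integral_comp_comm (hint v hv)).symm
    rw [h1]
    simp_rw [← hvT]
    exact (hμ g).integral_comp (hemb g) v
  let w : X → H := fun x => v x - m
  have hw : Continuous w := hv.sub continuous_const
  have hwT : ∀ g x, w (g • x) = T g (w x) := fun g x => by
    simp only [w, map_sub, hTm, hvT]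
  have hw0 : ∫ x, w x ∂μ = 0 := by
    simp only [w]
    rw [integral_sub (hint v hv) (integrable_const _)]
    simp [hm]
  let κ : X → H →L[ℂ] H := fun x => (innerSL ℂ (w x)).smulRight (w x)
  have hκ : Continuous κ := by
    have h1 : Continuous fun x => innerSL ℂ (w x) := (innerSL ℂ).continuous.comp hw
    exact (ContinuousLinearMap.smulRightL ℂ H H).continuous₂.comp (h1.prodMk hw)
  let S : H →L[ℂ] H := ∫ x, κ x ∂μ
  have hS : ∀ h, S h = ∫ x, (inner ℂ (w x) h : ℂ) • w x ∂μ := by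
    intro h
    exact ContinuousLinearMap.integral_apply (hint κ hκ) h
  have hci : ∀ h, Continuous fun x => (inner ℂ (w x) h : ℂ) := fun h => by fun_prop
  have hcs : ∀ h, Continuous fun x => (inner ℂ (w x) h : ℂ) • w x := fun h => by fun_prop
  have hSinner : ∀ h k, (inner ℂ k (S h) : ℂ) = ∫ x, inner ℂ (w x) h * inner ℂ k (w x) ∂μ := by
    intro h k
    rw [hS, ← integral_inner (hint _ (hcs h))]
    simp_rw [inner_smul_right]
  have hsymm : S.IsSymmetric := by
    intro h k
    change (inner ℂ (S h) k : ℂ) = inner ℂ h (S k)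
    rw [← inner_conj_symm, hSinner, hSinner, ← integral_conj]
    congr 1
    ext x
    simp only [map_mul, inner_conj_symm]
    ring
  have hScomm : ∀ g h, T g (S h) = S (T g h) := by
    intro g h
    have h1 : T g (S h) = ∫ x, T g ((inner ℂ (w x) h : ℂ) • w x) ∂μ := by
      rw [hS]
      exact ((T g).toContinuousLinearMap.integral_comp_comm (hint _ (hcs h))).symm
    rw [h1, hS, ← (hμ g).integral_comp (hemb g) (fun x => (inner ℂ (w x) (T g h) : ℂ) • w x)]
    congr 1
    ext x
    rw [hwT, map_smul, LinearIsometry.inner_map_map]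
  have hcomp : IsCompactOperator S := by
    obtain ⟨M, hM⟩ : ∃ M, ∀ x, ‖w x‖ ≤ M := by
      obtain ⟨M, hM⟩ := (isCompact_univ (X := X)).exists_bound_of_continuousOn hw.continuousOn
      exact ⟨M, fun x => hM x (mem_univ x)⟩
    let Q : Set H := (fun p : ℂ × X => p.1 • w p.2) '' (Metric.closedBall 0 M ×ˢ univ)
    have hQ : IsCompact Q :=
      ((isCompact_closedBall _ _).prod isCompact_univ).image (by fun_prop)
    have hQc : IsCompact (closure (convexHull ℝ Q)) :=
      isCompact_iff_totallyBounded_isComplete.2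
        ⟨(totallyBounded_convexHull.2 hQ.totallyBounded).closure, isClosed_closure.isComplete⟩
    refine (isCompactOperator_iff_image_closedBall_subset_compact (S : H →ₗ[ℂ] H) one_pos).2
      ⟨_, hQc, ?_⟩
    rintro _ ⟨h, hh, rfl⟩
    change S h ∈ _
    rw [hS]
    refine (convex_convexHull ℝ Q).closure.integral_mem isClosed_closure
      (Eventually.of_forall fun x => subset_closure (subset_convexHull ℝ Q ?_)) (hint _ (hcs h))
    refine ⟨(inner ℂ (w x) h, x), ⟨?_, mem_univ _⟩, rfl⟩
    rw [mem_closedBall_zero_iff] at hh ⊢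
    refine (norm_inner_le_norm _ _).trans ?_
    have := hM x
    nlinarith [norm_nonneg (w x), norm_nonneg h]
  have hwne : ∃ x, w x ≠ 0 := by
    by_contra! h
    obtain ⟨x, y, hxy⟩ := hne
    apply hxy
    have h1 := h x
    have h2 := h y
    simp only [w, sub_eq_zero] at h1 h2
    rw [h1, h2]
  have hSne : S ≠ 0 := by
    obtain ⟨x₀, hx₀⟩ := hwne
    intro h0
    have h1 := hSinner (w x₀) (w x₀)
    rw [h0] at h1
    have h2 : ∀ x, (inner ℂ (w x) (w x₀) * inner ℂ (w x₀) (w x) : ℂ) =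
        ((‖(inner ℂ (w x) (w x₀) : ℂ)‖ ^ 2 : ℝ) : ℂ) := by
      intro x
      rw [← inner_conj_symm (w x₀) (w x), Complex.mul_conj, Complex.normSq_eq_norm_sq]
    simp_rw [h2] at h1
    rw [integral_complex_ofReal] at h1
    have h3 : ∫ x, ‖(inner ℂ (w x) (w x₀) : ℂ)‖ ^ 2 ∂μ = 0 := by
      simpa using h1.symm
    have h4 : 0 < ∫ x, ‖(inner ℂ (w x) (w x₀) : ℂ)‖ ^ 2 ∂μ := by
      refine Continuous.integral_pos_of_hasCompactSupport_nonneg_nonzero (x := x₀) (by fun_prop)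
        (HasCompactSupport.of_compactSpace _) (fun x => by positivity) ?_
      simpa using hx₀
    exact h4.ne' h3
  obtain ⟨c, hc, hc0⟩ : ∃ c, Module.End.HasEigenvalue (S : Module.End ℂ H) c ∧ c ≠ 0 := by
    by_contra! h
    exact hSne ((ContinuousLinearMap.eq_zero_of_forall_hasEigenvalue_eq_zero hcomp hsymm).1 h)
  obtain ⟨h, hhE, hh0, hhT⟩ := common_eigenvector (fun g => (T g).toLinearMap) hT _
    (Module.End.eigenspace (S : Module.End ℂ H) c)
    (ContinuousLinearMap.finite_dimensional_eigenspace hcomp c hc0) rfl hc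
    (by
      intro g x hx
      rw [Module.End.mem_eigenspace_iff] at hx ⊢
      change S x = c • x at hx
      change S (T g x) = c • T g x
      rw [← hScomm, hx, map_smul])
  have hSh : S h = c • h := Module.End.mem_eigenspace_iff.1 hhE
  choose χ hχ using hhT
  have hχ' : ∀ g, T g h = χ g • h := hχ
  have hχ1 : ∀ g, ‖χ g‖ = 1 := by
    intro g
    have h1 := (T g).norm_map h
    rw [hχ', norm_smul] at h1
    exact mul_right_cancel₀ (norm_ne_zero_iff.2 hh0) (by rw [h1, one_mul])
  have hfc : Continuous fun x => (inner ℂ h (w x) : ℂ) := by fun_prop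
  refine ⟨fun x => inner ℂ h (w x), χ, hfc, hχ1, ?_, ?_⟩
  · intro g x
    have h1 := (T g).inner_map_map h (w x)
    rw [hχ', inner_smul_left, ← hwT] at h1
    simp only
    rw [← h1, ← mul_assoc, Complex.mul_conj, Complex.normSq_eq_norm_sq, hχ1]
    simp
  · by_contra! hall
    have hz : ∀ x, (inner ℂ h (w x) : ℂ) = 0 := by
      intro x
      have h1 : ∫ y, (inner ℂ h (w y) : ℂ) ∂μ = 0 := by
        rw [integral_inner (hint w hw), hw0, inner_zero_right]
      simp_rw [fun y => hall y x] at h1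
      simpa using h1
    have : S h = 0 := by
      rw [hS]
      simp_rw [fun x => inner_eq_zero_symm.1 (hz x)]
      simp
    rw [hSh] at this
    exact (smul_ne_zero hc0 hh0) this


theorem no_action {G X : Type*} [CommGroup G] [MulAction G X] [MetricSpace X]
    [CompactSpace X] [MeasurableSpace X] [BorelSpace X] [ContinuousConstSMul G X]
    [PathConnectedSpace X] (hX : HasPathLifts X)
    (hne : ∃ x y : X, x ≠ y)
    (hdist : ∀ x y : X, x ≠ y → 0 < ⨅ g : G, dist (g • x) (g • y))
    (hmin : ∀ x : X, Dense (range fun g : G => g • x)) : False := by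
  haveI : Nonempty X := let ⟨x, _⟩ := hne; ⟨x⟩
  obtain ⟨μ, hprob, hμ⟩ := exists_invariant_measure G X
  haveI : MulAction.IsMinimal G X := ⟨hmin⟩
  haveI : SMulInvariantMeasure G X μ :=
    ⟨fun g s hs => (hμ g).measure_preimage hs.nullMeasurableSet⟩
  haveI : μ.IsOpenPosMeasure := ⟨fun U hU hUne =>
    (measure_isOpen_pos_of_smulInvariant_of_compact_ne_zero G (isCompact_univ (X := X))
      (by simp) hU hUne).ne'⟩
  obtain ⟨W, hW, hWG, ⟨U, V, hU, hV, hUne, hVne, hUV⟩, p₀, hp₀⟩ :=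
    exists_proper_closed (G := G) hdist hne
  obtain ⟨T, v, hT, hv, hvT, hvne⟩ :=
    exists_equivariant_map hmin μ hμ W hW hWG U V hV hUne hVne hUV p₀ hp₀
  obtain ⟨f, χ, hf, hχ, hfχ, a, b, hab⟩ := exists_eigenfunction μ hμ T v hT hv hvT hvne
  have hnorm : ∀ x, ‖f x‖ = ‖f a‖ := by
    have hcl : IsClosed {x | ‖f x‖ = ‖f a‖} := isClosed_eq hf.norm continuous_const
    have hsub : range (fun g : G => g • a) ⊆ {x | ‖f x‖ = ‖f a‖} := by
      rintro _ ⟨g, rfl⟩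
      simp [hfχ, hχ]
    intro x
    exact hcl.closure_subset_iff.2 hsub (hmin a x)
  have hr : ‖f a‖ ≠ 0 := by
    intro h0
    apply hab
    have h1 := hnorm b
    rw [h0, norm_eq_zero] at h1
    rw [norm_eq_zero] at h0
    rw [h0, h1]
  let F : C(X, Circle) := ⟨fun x => ⟨f x / (‖f a‖ : ℂ), mem_sphere_zero_iff_norm.2 (by
    rw [norm_div, hnorm x, Complex.norm_real, norm_norm, div_self hr])⟩, by
      apply Continuous.subtype_mk
      exact hf.div_const _⟩
  let χ' : G → Circle := fun g => ⟨χ g, mem_sphere_zero_iff_norm.2 (hχ g)⟩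
  have hF := eigenfunction_const hX hmin μ hμ F χ' (fun g x => Subtype.ext (by
    change f (g • x) / (‖f a‖ : ℂ) = χ g * (f x / (‖f a‖ : ℂ))
    rw [hfχ, mul_div_assoc])) a b
  have h2 : f a / (‖f a‖ : ℂ) = f b / (‖f a‖ : ℂ) := congrArg Subtype.val hF
  have hrc : (‖f a‖ : ℂ) ≠ 0 := by exact_mod_cast hr
  exact hab ((div_left_inj' hrc).1 h2)

theorem no_action_hom {G X : Type*} [CommGroup G] [MetricSpace X]
    [CompactSpace X] [MeasurableSpace X] [BorelSpace X]
    [PathConnectedSpace X] (hX : HasPathLifts X)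
    (hne : ∃ x y : X, x ≠ y) (φ : G →* (X ≃ₜ X))
    (hdist : ∀ x y : X, x ≠ y → 0 < ⨅ g : G, dist (φ g x) (φ g y))
    (hmin : ∀ x : X, Dense (range fun g : G => φ g x)) : False := by
  letI : MulAction G X :=
    { smul := fun g x => φ g x
      one_smul := fun x => by
        change φ 1 x = x
        rw [map_one]; rfl
      mul_smul := fun g h x => by
        change φ (g * h) x = φ g (φ h x)
        rw [map_mul]; rfl }
  haveI : ContinuousConstSMul G X := ⟨fun g => (φ g).continuous⟩
  exact no_action (G := G) hX hne hdist hmin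

theorem S2_nontrivial : ∃ x y : S2, x ≠ y := by
  refine ⟨⟨EuclideanSpace.single 0 1, by simp⟩, ⟨-EuclideanSpace.single 0 1, by simp⟩, ?_⟩
  intro h
  have h1 := congrArg (fun z : S2 => (z : EuclideanSpace ℝ (Fin 3)) 0) h
  norm_num at h1

theorem S2_pathConnected : PathConnectedSpace S2 := by
  refine isPathConnected_iff_pathConnectedSpace.1 (isPathConnected_sphere ?_ _ zero_le_one)
  rw [← Module.finrank_eq_rank, finrank_euclideanSpace, Fintype.card_fin]
  norm_num

end DistalAux

/-- There is no distal minimal action of an abelian group on a simply connected compact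
metric space with more than one point; in particular the 2-sphere `S²` admits no distal
minimal action by an abelian group. -/
theorem no_distal_minimal_abelian_action_on_simply_connected :
    (∀ (G : Type u) [CommGroup G]
      (X : Type v) [MetricSpace X] [CompactSpace X] [SimplyConnectedSpace X],
      (∃ x y : X, x ≠ y) →
      ∀ φ : G →* (X ≃ₜ X),
        ¬ ((∀ x y : X, x ≠ y → 0 < ⨅ g : G, dist (φ g x) (φ g y)) ∧
           (∀ x : X, Dense (Set.range fun g : G => φ g x)))) ∧
    (∀ (G : Type u) [CommGroup G]
      (φ : G →* ((Metric.sphere (0 : EuclideanSpace ℝ (Fin 3)) 1) ≃ₜ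
                 (Metric.sphere (0 : EuclideanSpace ℝ (Fin 3)) 1))),
        ¬ ((∀ x y : Metric.sphere (0 : EuclideanSpace ℝ (Fin 3)) 1, x ≠ y →
              0 < ⨅ g : G, dist (φ g x) (φ g y)) ∧
           (∀ x : Metric.sphere (0 : EuclideanSpace ℝ (Fin 3)) 1,
              Dense (Set.range fun g : G => φ g x)))) := by
  refine ⟨?_, ?_⟩
  · intro G _ X _ _ _ hne φ h
    borelize X
    exact DistalAux.no_action_hom (DistalAux.hasPathLifts_of_simplyConnected X) hne φ h.1 h.2
  · intro G _ φ h
    haveI := DistalAux.S2_pathConnected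
    exact DistalAux.no_action_hom DistalAux.hasPathLifts_S2 DistalAux.S2_nontrivial φ h.1 h.2
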